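/- arXiv:2102.02198 — 2 statements merged into one kernel-verified Lean document; each statement's English description precedes it below -/
import Mathlib

section
/- Let X and Y be compact Hausdorff topological spaces, φ a dynamical system on X and ψ a dynamical system on Y (time ℝ≥0), and let (τ, f) be a quasiconjugacy from φ to ψ. Then: (1) for every attractor A of ψ, the set ω_φ(f⁻¹(A)) is an attractor of φ; (2) the map A ↦ ω_φ(f⁻¹(A)) is a lattice homomorphism from the attractors of ψ to the attractors of φ, i.e. for all attractors A, A′ of ψ one has ω_φ(f⁻¹(A ∪ A′)) = ω_φ(f⁻¹(A)) ∪ ω_φ(f⁻¹(A′)) and ω_φ(f⁻¹(ω_ψ(A ∩ A′))) = ω_φ(ω_φ(f⁻¹(A)) ∩ ω_φ(f⁻¹(A′))), where the meet of attractors B, B′ of a system θ is ω_θ(B ∩ B′). -/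
open Set Topology NNReal

/-- A dynamical system on `X` with time `ℝ≥0`. -/
def IsDynSys {X : Type*} [TopologicalSpace X] (φ : ℝ≥0 × X → X) : Prop :=
  Continuous φ ∧ (∀ x, φ (0, x) = x) ∧ ∀ t s x, φ (t, φ (s, x)) = φ (t + s, x)

/-- The ω-limit set of `U` under `φ`. -/
def omegaLim {X : Type*} [TopologicalSpace X] (φ : ℝ≥0 × X → X) (U : Set X) : Set X :=
  ⋂ t : ℝ≥0, closure (⋃ s : ℝ≥0, ⋃ _ : t ≤ s, (fun x => φ (s, x)) '' U)

/-- `A` is an attractor for `φ`: `A = ω_φ(U)` for some attracting neighborhood `U`. -/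
def IsAttractor {X : Type*} [TopologicalSpace X] (φ : ℝ≥0 × X → X) (A : Set X) : Prop :=
  ∃ U : Set X, omegaLim φ U ⊆ interior U ∧ A = omegaLim φ U

/-- A quasiconjugacy from `φ` on `X` to `ψ` on `Y`. -/
def IsQuasiConj {X Y : Type*} [TopologicalSpace X] [TopologicalSpace Y]
    (φ : ℝ≥0 × X → X) (ψ : ℝ≥0 × Y → Y) (τ : ℝ≥0 × X → ℝ≥0) (f : X → Y) : Prop :=
  Continuous f ∧ Continuous τ ∧ (∀ x, τ (0, x) = 0) ∧
    (∀ x, StrictMono fun t => τ (t, x)) ∧ (∀ x, Function.Surjective fun t => τ (t, x)) ∧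
    ∀ t x, f (φ (t, x)) = ψ (τ (t, x), f x)

def orbT {X : Type*} (φ : ℝ≥0 × X → X) (U : Set X) (t : ℝ≥0) : Set X :=
  ⋃ s : ℝ≥0, ⋃ _ : t ≤ s, (fun x => φ (s, x)) '' U

theorem mem_orbT {X : Type*} {φ : ℝ≥0 × X → X} {U : Set X} {t : ℝ≥0} {y : X} :
    y ∈ orbT φ U t ↔ ∃ s, t ≤ s ∧ ∃ x ∈ U, φ (s, x) = y := by
  simp [orbT]

theorem mem_omegaLim {X : Type*} [TopologicalSpace X] {φ : ℝ≥0 × X → X} {U : Set X} {y : X} :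
    y ∈ omegaLim φ U ↔ ∀ t, y ∈ closure (orbT φ U t) := by
  simp only [omegaLim, orbT, mem_iInter]

theorem orbT_anti {X : Type*} {φ : ℝ≥0 × X → X} {U : Set X} {t t' : ℝ≥0} (h : t ≤ t') :
    orbT φ U t' ⊆ orbT φ U t := by
  intro y hy
  obtain ⟨s, hs, x, hx, rfl⟩ := mem_orbT.1 hy
  exact mem_orbT.2 ⟨s, h.trans hs, x, hx, rfl⟩

theorem omegaLim_mono {X : Type*} [TopologicalSpace X] (φ : ℝ≥0 × X → X) {U V : Set X}
    (h : U ⊆ V) : omegaLim φ U ⊆ omegaLim φ V := by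
  intro y hy
  rw [mem_omegaLim] at hy ⊢
  intro t
  refine closure_mono ?_ (hy t)
  intro z hz
  obtain ⟨s, hs, x, hx, rfl⟩ := mem_orbT.1 hz
  exact mem_orbT.2 ⟨s, hs, x, h hx, rfl⟩

theorem omegaLim_closed {X : Type*} [TopologicalSpace X] (φ : ℝ≥0 × X → X) (U : Set X) :
    IsClosed (omegaLim φ U) := isClosed_iInter fun _ => isClosed_closure

theorem omegaLim_union {X : Type*} [TopologicalSpace X] (φ : ℝ≥0 × X → X) (U V : Set X) :
    omegaLim φ (U ∪ V) = omegaLim φ U ∪ omegaLim φ V := by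
  apply Subset.antisymm
  · intro y hy
    by_contra hn
    simp only [mem_union, not_or, mem_omegaLim, not_forall] at hn
    obtain ⟨⟨t, ht⟩, ⟨t', ht'⟩⟩ := hn
    have h1 := mem_omegaLim.1 hy (max t t')
    have h2 : orbT φ (U ∪ V) (max t t') ⊆ orbT φ U t ∪ orbT φ V t' := by
      intro z hz
      obtain ⟨s, hs, x, hx, rfl⟩ := mem_orbT.1 hz
      rcases hx with hx | hx
      · exact Or.inl (mem_orbT.2 ⟨s, (le_max_left _ _).trans hs, x, hx, rfl⟩)
      · exact Or.inr (mem_orbT.2 ⟨s, (le_max_right _ _).trans hs, x, hx, rfl⟩)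
    have h3 := closure_mono h2 h1
    rw [closure_union] at h3
    exact h3.elim ht ht'
  · exact union_subset (omegaLim_mono φ subset_union_left) (omegaLim_mono φ subset_union_right)

theorem cont_slice {X : Type*} [TopologicalSpace X] {φ : ℝ≥0 × X → X} (hφ : IsDynSys φ)
    (s : ℝ≥0) : Continuous fun x => φ (s, x) :=
  hφ.1.comp (by fun_prop)

theorem omegaLim_fwd {X : Type*} [TopologicalSpace X] {φ : ℝ≥0 × X → X} (hφ : IsDynSys φ)
    (U : Set X) (s : ℝ≥0) {x : X} (hx : x ∈ omegaLim φ U) : φ (s, x) ∈ omegaLim φ U := by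
  rw [mem_omegaLim] at hx ⊢
  intro t
  refine map_mem_closure (f := fun x => φ (s, x)) (cont_slice hφ s) (hx t) ?_
  intro z hz
  obtain ⟨r, hr, x, hx, rfl⟩ := mem_orbT.1 hz
  exact mem_orbT.2 ⟨s + r, hr.trans le_add_self, x, hx, (hφ.2.2 s r x).symm⟩

theorem omegaLim_bwd {X : Type*} [TopologicalSpace X] [CompactSpace X] [T2Space X]
    {φ : ℝ≥0 × X → X} (hφ : IsDynSys φ)
    (U : Set X) (s : ℝ≥0) {y : X} (hy : y ∈ omegaLim φ U) :
    ∃ x ∈ omegaLim φ U, φ (s, x) = y := by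
  rw [mem_omegaLim] at hy
  have hcl : IsClosed ((fun x => φ (s, x)) ⁻¹' {y}) :=
    isClosed_singleton.preimage (cont_slice hφ s)
  have hne : (⋂ t : ℝ≥0, closure (orbT φ U t) ∩ (fun x => φ (s, x)) ⁻¹' {y}).Nonempty := by
    apply IsCompact.nonempty_iInter_of_directed_nonempty_isCompact_isClosed
    · intro a b
      exact ⟨max a b, inter_subset_inter_left _ (closure_mono (orbT_anti (le_max_left _ _))),
        inter_subset_inter_left _ (closure_mono (orbT_anti (le_max_right _ _)))⟩
    · intro t
      have hc : IsClosed ((fun x => φ (s, x)) '' closure (orbT φ U t)) :=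
        (isClosed_closure.isCompact.image (cont_slice hφ s)).isClosed
      have hsub : orbT φ U (s + t) ⊆ (fun x => φ (s, x)) '' closure (orbT φ U t) := by
        intro z hz
        obtain ⟨r, hr, x, hx, rfl⟩ := mem_orbT.1 hz
        obtain ⟨q, rfl⟩ := exists_add_of_le hr
        refine ⟨φ (t + q, x), subset_closure (mem_orbT.2 ⟨t + q, le_self_add, x, hx, rfl⟩), ?_⟩
        simp only [hφ.2.2, add_assoc]
      obtain ⟨x, hx, hxy⟩ := closure_minimal hsub hc (hy (s + t))
      exact ⟨x, hx, hxy⟩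
    · exact fun t => (isClosed_closure.inter hcl).isCompact
    · exact fun t => isClosed_closure.inter hcl
  obtain ⟨x, hx⟩ := hne
  rw [mem_iInter] at hx
  exact ⟨x, mem_omegaLim.2 fun t => (hx t).1, (hx 0).2⟩

theorem omegaLim_sub {X : Type*} [TopologicalSpace X] [CompactSpace X] [T2Space X]
    {φ : ℝ≥0 × X → X} (hφ : IsDynSys φ) {U V : Set X} (h : omegaLim φ U ⊆ V) :
    omegaLim φ U ⊆ omegaLim φ V := by
  intro y hy
  refine mem_omegaLim.2 fun t => subset_closure ?_
  obtain ⟨x, hx, hxy⟩ := omegaLim_bwd hφ U t hy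
  exact mem_orbT.2 ⟨t, le_rfl, x, h hx, hxy⟩

theorem omegaLim_sub_self {X : Type*} [TopologicalSpace X] {φ : ℝ≥0 × X → X} {B : Set X}
    (hc : IsClosed B) (hf : ∀ s, ∀ x ∈ B, φ (s, x) ∈ B) : omegaLim φ B ⊆ B := by
  intro y hy
  refine closure_minimal ?_ hc (mem_omegaLim.1 hy 0)
  intro z hz
  obtain ⟨s, -, x, hx, rfl⟩ := mem_orbT.1 hz
  exact hf s x hx

theorem tau_large {X : Type*} [TopologicalSpace X] [CompactSpace X] {τ : ℝ≥0 × X → ℝ≥0}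
    (hc : Continuous τ) (hm : ∀ x, StrictMono fun t => τ (t, x))
    (hs : ∀ x, Function.Surjective fun t => τ (t, x)) (T : ℝ≥0) :
    ∃ t, ∀ s, t ≤ s → ∀ x, T ≤ τ (s, x) := by
  have key : ∃ t, (univ : Set X) ⊆ {x | T < τ (t, x)} := by
    apply isCompact_univ.elim_directed_cover (fun t => {x | T < τ (t, x)})
    · intro t
      exact isOpen_lt continuous_const (hc.comp (by fun_prop))
    · intro x _
      obtain ⟨t, ht⟩ := hs x (T + 1)
      have ht' : τ (t, x) = T + 1 := ht
      refine mem_iUnion.2 ⟨t, ?_⟩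
      simp [ht']
    · intro a b
      refine ⟨max a b, fun x hx => lt_of_lt_of_le hx ((hm x).monotone (le_max_left _ _)),
        fun x hx => lt_of_lt_of_le hx ((hm x).monotone (le_max_right _ _))⟩
  obtain ⟨t, ht⟩ := key
  exact ⟨t, fun s hs x => le_of_lt (lt_of_lt_of_le (ht (mem_univ x)) ((hm x).monotone hs))⟩

theorem omegaLim_quasi {X Y : Type*} [TopologicalSpace X] [CompactSpace X]
    [TopologicalSpace Y] {φ : ℝ≥0 × X → X} {ψ : ℝ≥0 × Y → Y}
    {τ : ℝ≥0 × X → ℝ≥0} {f : X → Y} (h : IsQuasiConj φ ψ τ f) (U : Set Y) :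
    omegaLim φ (f ⁻¹' U) ⊆ f ⁻¹' omegaLim ψ U := by
  obtain ⟨hf, hτ, -, hm, hs, hq⟩ := h
  intro y hy
  refine mem_omegaLim.2 fun T => ?_
  obtain ⟨t, ht⟩ := tau_large hτ hm hs T
  refine map_mem_closure hf (mem_omegaLim.1 hy t) ?_
  intro z hz
  obtain ⟨s, hs, x, hx, rfl⟩ := mem_orbT.1 hz
  exact mem_orbT.2 ⟨τ (s, x), ht s hs x, f x, hx, (hq s x).symm⟩

/-- For a quasiconjugacy `(τ, f) : φ → ψ` between dynamical systems on compact Hausdorff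
spaces: (1) for every attractor `A` of `ψ`, `ω_φ(f⁻¹(A))` is an attractor of `φ`;
(2) `A ↦ ω_φ(f⁻¹(A))` is a lattice homomorphism for the attractor lattices, where the join is
union and the meet of attractors `B, B′` of a system `θ` is `ω_θ(B ∩ B′)`. -/
theorem stmt3 {X Y : Type*} [TopologicalSpace X] [CompactSpace X] [T2Space X]
    [TopologicalSpace Y] [CompactSpace Y] [T2Space Y]
    (φ : ℝ≥0 × X → X) (ψ : ℝ≥0 × Y → Y) (hφ : IsDynSys φ) (hψ : IsDynSys ψ)
    (τ : ℝ≥0 × X → ℝ≥0) (f : X → Y) (h : IsQuasiConj φ ψ τ f) :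
    (∀ A : Set Y, IsAttractor ψ A → IsAttractor φ (omegaLim φ (f ⁻¹' A))) ∧
      ∀ A A' : Set Y, IsAttractor ψ A → IsAttractor ψ A' →
        omegaLim φ (f ⁻¹' (A ∪ A')) = omegaLim φ (f ⁻¹' A) ∪ omegaLim φ (f ⁻¹' A') ∧
        omegaLim φ (f ⁻¹' omegaLim ψ (A ∩ A')) =
          omegaLim φ (omegaLim φ (f ⁻¹' A) ∩ omegaLim φ (f ⁻¹' A')) := by
  refine ⟨?_, ?_⟩
  · rintro A ⟨U, hU, rfl⟩
    have h1 := omegaLim_quasi h U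
    have hsub : f ⁻¹' omegaLim ψ U ⊆ interior (f ⁻¹' U) :=
      (preimage_mono hU).trans (preimage_interior_subset_interior_preimage h.1)
    refine ⟨f ⁻¹' U, h1.trans hsub, Subset.antisymm ?_ (omegaLim_sub hφ h1)⟩
    exact omegaLim_mono φ (hsub.trans interior_subset)
  · rintro A A' ⟨U, hU, rfl⟩ ⟨U', hU', rfl⟩
    refine ⟨by rw [preimage_union, omegaLim_union], ?_⟩
    set A := omegaLim ψ U with hA
    set A' := omegaLim ψ U' with hA'
    have clA : IsClosed A := omegaLim_closed ψ U
    have clA' : IsClosed A' := omegaLim_closed ψ U'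
    have fA : ∀ s, ∀ x ∈ A, ψ (s, x) ∈ A := fun s x hx => omegaLim_fwd hψ U s hx
    have fA' : ∀ s, ∀ x ∈ A', ψ (s, x) ∈ A' := fun s x hx => omegaLim_fwd hψ U' s hx
    have hI : omegaLim ψ (A ∩ A') ⊆ A ∩ A' :=
      omegaLim_sub_self (clA.inter clA') fun s x hx => ⟨fA s x hx.1, fA' s x hx.2⟩
    apply Subset.antisymm
    · apply omegaLim_sub hφ
      exact subset_inter (omegaLim_mono φ (preimage_mono (hI.trans inter_subset_left)))
        (omegaLim_mono φ (preimage_mono (hI.trans inter_subset_right)))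
    · apply omegaLim_sub hφ
      refine Subset.trans (omegaLim_mono φ ?_) (omegaLim_quasi h (A ∩ A'))
      intro x hx
      exact ⟨omegaLim_sub_self clA fA (omegaLim_quasi h A hx.1),
        omegaLim_sub_self clA' fA' (omegaLim_quasi h A' hx.2)⟩
end

section
/- Let D be a topological space, P and P′ types, E : D → Set P and E′ : D → Set P′ stable families, and n : D → P → P′ a family with n(φ)(U) ∈ E′(φ) whenever U ∈ E(φ). Equip Π[E] and Π[E′] with their étalé topologies. Then the map Π[n] : Π[E] → Π[E′], (φ,U) ↦ (φ, n(φ)(U)), is continuous if and only if for every pair U ∈ P, U′ ∈ P′ the set {φ ∈ Φ[E;U] : n(φ)(U) = U′} is open in D. -/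
open Set Topology TopologicalSpace

/-- `Φ[E;U] = {φ ∈ D : U ∈ E(φ)}`. -/
def PhiSet {D P : Type*} (E : D → Set P) (U : P) : Set D := {φ : D | U ∈ E φ}

/-- `E` is stable: every `Φ[E;U]` is open. -/
def IsStable {D P : Type*} [TopologicalSpace D] (E : D → Set P) : Prop :=
  ∀ U : P, IsOpen (PhiSet E U)

/-- The underlying set of the étalé space `Π[E]`. -/
def PiE {D P : Type*} (E : D → Set P) : Type _ := {p : D × P // p.2 ∈ E p.1}

/-- The étalé topology on `Π[E]`. -/
def etaleTopE {D P : Type*} [TopologicalSpace D] (E : D → Set P) :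
    TopologicalSpace (PiE E) :=
  TopologicalSpace.generateFrom
    {V : Set (PiE E) | ∃ (U : P) (Ω : Set D), IsOpen Ω ∧ Ω ⊆ PhiSet E U ∧
      V = {p : PiE E | p.1.1 ∈ Ω ∧ p.1.2 = U}}

/-- The map `Π[n] : Π[E] → Π[E′]`, `(φ,U) ↦ (φ, n(φ)(U))`, for a family `n` mapping `E`
into `E′` componentwise. -/
def PiN {D P P' : Type*} (E : D → Set P) (E' : D → Set P') (n : D → P → P')
    (hn : ∀ (φ : D), ∀ U ∈ E φ, n φ U ∈ E' φ) : PiE E → PiE E' :=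
  fun p => ⟨(p.1.1, n p.1.1 p.1.2), hn p.1.1 p.1.2 p.2⟩

theorem isOpen_slice_aux {D P : Type*} [TopologicalSpace D] (E : D → Set P)
    (hE : IsStable E) (W : Set (PiE E)) (hW : IsOpen[etaleTopE E] W) (U : P) :
    IsOpen {φ : D | ∃ h : U ∈ E φ, (⟨(φ, U), h⟩ : PiE E) ∈ W} := by
  have hW' : TopologicalSpace.GenerateOpen {V : Set (PiE E) | ∃ (U : P) (Ω : Set D),
      IsOpen Ω ∧ Ω ⊆ PhiSet E U ∧ V = {p : PiE E | p.1.1 ∈ Ω ∧ p.1.2 = U}} W := hW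
  clear hW
  induction hW' with
  | basic s hs =>
    obtain ⟨U₀, Ω, hΩ, hsub, rfl⟩ := hs
    by_cases h : U = U₀
    · subst h
      convert hΩ using 1
      ext φ
      exact ⟨fun ⟨_, h, _⟩ => h, fun h => ⟨hsub h, h, rfl⟩⟩
    · convert isOpen_empty using 1
      ext φ
      exact ⟨fun ⟨_, _, h'⟩ => h h', fun h => h.elim⟩
  | univ =>
    convert hE U using 1
    ext φ
    exact ⟨fun ⟨h, _⟩ => h, fun h => ⟨h, trivial⟩⟩
  | inter s t _ _ hs ht =>
    convert hs.inter ht using 1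
    ext φ
    exact ⟨fun ⟨h, h1, h2⟩ => ⟨⟨h, h1⟩, ⟨h, h2⟩⟩, fun ⟨⟨h, h1⟩, ⟨_, h2⟩⟩ => ⟨h, h1, h2⟩⟩
  | sUnion S _ ih =>
    convert isOpen_biUnion ih using 1
    ext φ
    simp only [Set.mem_iUnion]
    exact ⟨fun ⟨h, t, ht, h1⟩ => ⟨t, ht, h, h1⟩, fun ⟨t, ht, h, h1⟩ => ⟨h, t, ht, h1⟩⟩

/-- For stable families `E`, `E′` and a componentwise map `n`, the induced map
`Π[n] : Π[E] → Π[E′]` is continuous iff the sets `{φ ∈ Φ[E;U] : n(φ)(U) = U′}` are open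
for every pair `U, U′`. -/
theorem stmt10 {D P P' : Type*} [TopologicalSpace D] (E : D → Set P) (E' : D → Set P')
    (hE : IsStable E) (hE' : IsStable E') (n : D → P → P')
    (hn : ∀ (φ : D), ∀ U ∈ E φ, n φ U ∈ E' φ) :
    letI : TopologicalSpace (PiE E) := etaleTopE E
    letI : TopologicalSpace (PiE E') := etaleTopE E'
    Continuous (PiN E E' n hn) ↔
      ∀ (U : P) (U' : P'), IsOpen {φ : D | φ ∈ PhiSet E U ∧ n φ U = U'} := by
  letI τ : TopologicalSpace (PiE E) := etaleTopE E
  letI τ' : TopologicalSpace (PiE E') := etaleTopE E'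
  constructor
  · intro hc U U'
    have hb : IsOpen[etaleTopE E'] {p : PiE E' | p.1.1 ∈ PhiSet E' U' ∧ p.1.2 = U'} :=
      TopologicalSpace.isOpen_generateFrom_of_mem ⟨U', _, hE' U', subset_rfl, rfl⟩
    convert isOpen_slice_aux E hE _ (hc.isOpen_preimage _ hb) U using 1
    ext φ
    constructor
    · rintro ⟨h, rfl⟩
      exact ⟨h, hn φ U h, rfl⟩
    · rintro ⟨h, _, h2⟩
      exact ⟨h, h2⟩
  · intro h
    refine continuous_generateFrom_iff.2 ?_
    rintro _ ⟨U', Ω, hΩ, hsub, rfl⟩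
    have key : ∀ U : P, IsOpen[etaleTopE E] {p : PiE E | p.1.1 ∈
        Ω ∩ {φ : D | φ ∈ PhiSet E U ∧ n φ U = U'} ∧ p.1.2 = U} := fun U =>
      TopologicalSpace.isOpen_generateFrom_of_mem
        ⟨U, _, hΩ.inter (h U U'), fun _ hx => hx.2.1, rfl⟩
    convert isOpen_iUnion key using 1
    ext p
    simp only [Set.mem_iUnion]
    constructor
    · rintro ⟨h1, h2⟩
      exact ⟨p.1.2, ⟨h1, p.2, h2⟩, rfl⟩
    · rintro ⟨U, ⟨h1, h2, h3⟩, rfl⟩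
      exact ⟨h1, h3⟩
end
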